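/- Let X be a tropical curve with polarization μ of degree d. Then every degree-d divisor on X is linearly equivalent to a μ-polystable divisor on X. -/

import Mathlib

open scoped Classical

/-- A finite multigraph: finite vertex and edge types, with source and target maps
(an orientation is fixed on each edge). -/
structure Multigraph where
  V : Type
  E : Type
  [fintypeV : Fintype V]
  [fintypeE : Fintype E]
  [decEqV : DecidableEq V]
  [decEqE : DecidableEq E]
  s : E → V
  t : E → V

attribute [instance] Multigraph.fintypeV Multigraph.fintypeE
attribute [instance] Multigraph.decEqV Multigraph.decEqE

namespace Multigraph

variable (G : Multigraph)

/-- Adjacency using only edges in `F`. -/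
def adjOn (F : Finset G.E) (u v : G.V) : Prop :=
  ∃ e ∈ F, (G.s e = u ∧ G.t e = v) ∨ (G.s e = v ∧ G.t e = u)

/-- Adjacency in `G`. -/
def adj : G.V → G.V → Prop := G.adjOn Finset.univ

/-- `G` is connected. -/
def Connected : Prop := ∀ u v : G.V, Relation.EqvGen G.adj u v

/-- Number of connected components of the spanning subgraph with edge set `F`. -/
noncomputable def b0 (F : Finset G.E) : ℕ :=
  Nat.card (Quotient (Relation.EqvGen.setoid (G.adjOn F)))

/-- `E(A∖B, B∖A)`: the set of edges connecting `A∖B` to `B∖A`. -/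
def crossEdges (A B : Finset G.V) : Finset G.E :=
  Finset.univ.filter fun e =>
    (G.s e ∈ A \ B ∧ G.t e ∈ B \ A) ∨ (G.s e ∈ B \ A ∧ G.t e ∈ A \ B)

/-- The valence of `v` in the edge set `F` (loops count twice). -/
def valE (F : Finset G.E) (v : G.V) : ℕ :=
  (F.filter fun e => G.s e = v).card + (F.filter fun e => G.t e = v).card

/-- `β_D(S) = deg(D|_S) − μ(S) + δ_{Γ,S}/2`. -/
noncomputable def beta (μ : G.V → ℝ) (D : G.V → ℤ) (S : Finset G.V) : ℝ :=
  (∑ v ∈ S, (D v : ℝ)) - (∑ v ∈ S, μ v) + (G.crossEdges S Sᶜ).card / 2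

end Multigraph

/-- A pseudo-divisor `(𝓔, D)` on `G`: a subset `𝓔` of edges and the divisor on the
subdivision `Γ^𝓔` which takes the value `−1` at each exceptional vertex; it is recorded
by its values `D` on the original vertices. -/
structure PseudoDiv (G : Multigraph) where
  E : Finset G.E
  D : G.V → ℤ

namespace Multigraph

variable (G : Multigraph)

/-- The degree of a pseudo-divisor: `∑ D(v) − |𝓔|` (the exceptional vertices contribute `−1`). -/
def degP (P : PseudoDiv G) : ℤ := (∑ v, P.D v) - P.E.card

/-- `β_{𝓔,D}(S) = deg(D|_S) − μ_𝓔(S) + δ_{Γ_𝓔,S}/2`, where `μ_𝓔(v) = μ(v) + val_𝓔(v)/2`. -/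
noncomputable def betaP (μ : G.V → ℝ) (P : PseudoDiv G) (S : Finset G.V) : ℝ :=
  (∑ v ∈ S, (P.D v : ℝ)) - (∑ v ∈ S, (μ v + (G.valE P.E v : ℝ) / 2))
    + ((G.crossEdges S Sᶜ).filter fun e => e ∉ P.E).card / 2

/-- `(𝓔,D)` is `μ`-semistable. -/
def Semistable (μ : G.V → ℝ) (P : PseudoDiv G) : Prop :=
  ∀ S : Finset G.V, 0 ≤ G.betaP μ P S

/-- `(𝓔,D)` is `μ`-polystable: `β ≥ 0` always, with strict inequality whenever
`E(S,Sᶜ) ⊄ 𝓔`. -/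
def Polystable (μ : G.V → ℝ) (P : PseudoDiv G) : Prop :=
  ∀ S : Finset G.V, 0 ≤ G.betaP μ P S ∧
    (¬ G.crossEdges S Sᶜ ⊆ P.E → 0 < G.betaP μ P S)

/-- `(v₀,μ)`-quasistability for a pseudo-divisor. -/
def Quasistable (v₀ : G.V) (μ : G.V → ℝ) (P : PseudoDiv G) : Prop :=
  ∀ S : Finset G.V, S ≠ Finset.univ →
    (0 ≤ G.betaP μ P S ∧ (v₀ ∈ S → 0 < G.betaP μ P S))

/-- A specialization `P ≥ Q` witnessed by the choice `a`, which assigns to each edge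
`e ∈ P.E ∖ Q.E` the endpoint onto which the exceptional vertex of `e` is contracted. -/
def SpecChoice (P Q : PseudoDiv G) (a : G.E → G.V) : Prop :=
  Q.E ⊆ P.E ∧ (∀ e, a e = G.s e ∨ a e = G.t e) ∧
    ∀ v, Q.D v = P.D v - ((P.E \ Q.E).filter fun e => a e = v).card

/-- The specialization relation on pseudo-divisors: `Spec P Q` means `P ≥ Q`. -/
def Spec (P Q : PseudoDiv G) : Prop := ∃ a, G.SpecChoice P Q a

/-- The rank `rk(𝓔,D) = |𝓔| − b₀(Γ_𝓔) + b₀(Γ)`. -/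
noncomputable def rk (P : PseudoDiv G) : ℤ :=
  (P.E.card : ℤ) - G.b0 P.Eᶜ + G.b0 Finset.univ

end Multigraph

/-- The points of the tropical curve with model `G` and edge lengths `ℓ`: vertices,
together with interior points `(e, t)` of edges, `0 < t < ℓ(e)` (the coordinate on each
edge runs from the source to the target). -/
def TropPt (G : Multigraph) (ℓ : G.E → ℝ) : Type :=
  G.V ⊕ {p : G.E × ℝ // 0 < p.2 ∧ p.2 < ℓ p.1}

/-- `g` is piecewise linear with integer slopes on `[0, L]`. -/
def PiecewiseLinear (L : ℝ) (g : ℝ → ℝ) : Prop :=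
  ∃ (n : ℕ) (x : Fin (n + 1) → ℝ) (m : Fin n → ℤ),
    x 0 = 0 ∧ x (Fin.last n) = L ∧ Monotone x ∧
    ∀ i : Fin n, ∀ t ∈ Set.Icc (x i.castSucc) (x i.succ),
      g t = g (x i.castSucc) + (m i : ℝ) * (t - x i.castSucc)

/-- The right-hand slope of `g` at `t`. -/
noncomputable def rightSlope (g : ℝ → ℝ) (t : ℝ) : ℝ := derivWithin g (Set.Ici t) t

/-- The left-hand slope of `g` at `t`. -/
noncomputable def leftSlope (g : ℝ → ℝ) (t : ℝ) : ℝ := derivWithin g (Set.Iic t) t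

/-- A rational function on the tropical curve with model `G` and lengths `ℓ`: values at
the vertices and a piecewise linear function with integer slopes along each edge,
compatible at the endpoints. -/
structure RatFn (G : Multigraph) (ℓ : G.E → ℝ) where
  vertVal : G.V → ℝ
  edgeFn : G.E → ℝ → ℝ
  source_eq : ∀ e, edgeFn e 0 = vertVal (G.s e)
  target_eq : ∀ e, edgeFn e (ℓ e) = vertVal (G.t e)
  pl : ∀ e, PiecewiseLinear (ℓ e) (edgeFn e)

/-- The value of a rational function at a point of the tropical curve. -/
noncomputable def RatFn.value {G : Multigraph} {ℓ : G.E → ℝ} (f : RatFn G ℓ) :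
    TropPt G ℓ → ℝ
  | Sum.inl v => f.vertVal v
  | Sum.inr p => f.edgeFn p.1.1 p.1.2

/-- The principal divisor `Div(f)` of a rational function `f`: at each point, the sum of
the incoming slopes of `f`. -/
noncomputable def RatFn.div {G : Multigraph} {ℓ : G.E → ℝ} (f : RatFn G ℓ) :
    TropPt G ℓ → ℝ
  | Sum.inl v =>
      ∑ e, ((if G.s e = v then -rightSlope (f.edgeFn e) 0 else 0) +
            (if G.t e = v then leftSlope (f.edgeFn e) (ℓ e) else 0))
  | Sum.inr p => leftSlope (f.edgeFn p.1.1) p.1.2 - rightSlope (f.edgeFn p.1.1) p.1.2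

/-- The unitary divisor on the tropical curve associated to the combinatorial data
`(𝓔, D)` together with a point `p_e` (of value `−1`) in the interior of each edge
`e ∈ 𝓔`. -/
noncomputable def unitaryDiv (G : Multigraph) (ℓ : G.E → ℝ) (P : PseudoDiv G)
    (p : G.E → ℝ) : TropPt G ℓ → ℤ
  | Sum.inl v => P.D v
  | Sum.inr x => if x.1.1 ∈ P.E ∧ p x.1.1 = x.1.2 then -1 else 0


/-! ### The piecewise linear interpolation of `u ^ 2 / 2` at the integers -/

/-- The piecewise linear interpolation of `u ^ 2 / 2` at the integers. -/
noncomputable def interpSq (u : ℝ) : ℝ := u ^ 2 / 2 + Int.fract u * (1 - Int.fract u) / 2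

lemma interpSq_eq (u : ℝ) :
    interpSq u = (⌊u⌋ + 1 / 2) * u - ⌊u⌋ * (⌊u⌋ + 1) / 2 := by
  simp only [interpSq, Int.fract]
  ring

lemma continuous_interpSq : Continuous interpSq := by
  have h : Continuous fun u : ℝ => Int.fract u * (1 - Int.fract u) := by
    have hf : Continuous fun a : ℝ => a * (1 - a) := by fun_prop
    exact hf.continuousOn.comp_fract'' (by simp)
  unfold interpSq
  fun_prop

lemma sq_div_two_le_interpSq (u : ℝ) : u ^ 2 / 2 ≤ interpSq u := by
  have h0 := Int.fract_nonneg u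
  have h1 := (Int.fract_lt_one u).le
  have := mul_nonneg h0 (sub_nonneg.2 h1)
  unfold interpSq
  linarith

lemma interpSq_neg (u : ℝ) : interpSq (-u) = interpSq u := by
  by_cases h : Int.fract u = 0
  · have h' : Int.fract (-u) = 0 := Int.fract_neg_eq_zero.2 h
    simp [interpSq, h, h']
  · simp only [interpSq, Int.fract_neg h]
    ring

open Filter Topology in
lemma eventually_floor_add_div (u : ℝ) {c : ℝ} (hc : 0 < c) :
    ∀ᶠ ε in 𝓝[>] (0 : ℝ), ⌊u + ε / c⌋ = ⌊u⌋ ∧ Int.fract (u + ε / c) ≠ 0 := by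
  have hpos : 0 < c * (⌊u⌋ + 1 - u) := mul_pos hc (by linarith [Int.lt_floor_add_one u])
  filter_upwards [Ioo_mem_nhdsGT hpos] with ε hε
  have h1 : 0 < ε / c := div_pos hε.1 hc
  have h2 : ε / c < ⌊u⌋ + 1 - u := by
    rw [div_lt_iff₀ hc]; linarith [hε.2]
  have h3 : ⌊u + ε / c⌋ = ⌊u⌋ :=
    Int.floor_eq_iff.2 ⟨by linarith [Int.floor_le u], by linarith⟩
  refine ⟨h3, ?_⟩
  rw [Int.fract, h3]
  have := Int.floor_le u
  exact ne_of_gt (by linarith)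

open Filter Topology in
lemma eventually_interpSq_add_div (u : ℝ) {c : ℝ} (hc : 0 < c) :
    ∀ᶠ ε in 𝓝[>] (0 : ℝ), c * interpSq (u + ε / c) = c * interpSq u + ε * (⌊u⌋ + 1 / 2) ∧
      Int.fract (u + ε / c) ≠ 0 := by
  filter_upwards [eventually_floor_add_div u hc] with ε hε
  refine ⟨?_, hε.2⟩
  rw [interpSq_eq, interpSq_eq, hε.1]
  field_simp
  ring

open Filter Topology in
lemma eventually_interpSq_sub_div (u : ℝ) {c : ℝ} (hc : 0 < c) :
    ∀ᶠ ε in 𝓝[>] (0 : ℝ), c * interpSq (u - ε / c) = c * interpSq u + ε * (1 / 2 - ⌈u⌉) ∧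
      Int.fract (u - ε / c) ≠ 0 := by
  filter_upwards [eventually_interpSq_add_div (-u) hc] with ε hε
  have hneg : -u + ε / c = -(u - ε / c) := by ring
  rw [hneg, interpSq_neg, interpSq_neg, Int.floor_neg] at hε
  refine ⟨?_, fun h => hε.2 (Int.fract_neg_eq_zero.2 h)⟩
  rw [hε.1]
  push_cast
  ring

/-! ### An energy functional on vertex potentials -/

namespace Multigraph

section Energy

variable (G : Multigraph) (ℓ A : G.E → ℝ) (b : G.V → ℝ)

/-- The slope along `e` of a potential `x` on the vertices, after shifting its increment along `e`
by `A e`. -/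
noncomputable def edgeSlope (x : G.V → ℝ) (e : G.E) : ℝ := (x (G.t e) - x (G.s e) - A e) / ℓ e

/-- The energy of a potential `x` on the vertices. -/
noncomputable def energy (x : G.V → ℝ) : ℝ :=
  ∑ e, ℓ e * interpSq (G.edgeSlope ℓ A x e) - ∑ v, b v * x v

/-- The edges along which the slope of `x` is not an integer. -/
noncomputable def brokenEdges (x : G.V → ℝ) : Finset G.E :=
  Finset.univ.filter fun e => Int.fract (G.edgeSlope ℓ A x e) ≠ 0

/-- The potential obtained from `x` by decreasing it by `ε` on `S`. -/
noncomputable def lower (x : G.V → ℝ) (S : Finset G.V) (ε : ℝ) (v : G.V) : ℝ :=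
  x v - if v ∈ S then ε else 0

/-- The contribution of the edge `e` to the derivative of the energy when the potential is lowered
on `S`. -/
noncomputable def edgeDeriv (x : G.V → ℝ) (S : Finset G.V) (e : G.E) : ℝ :=
  if G.s e ∈ S then (if G.t e ∈ S then 0 else ⌊G.edgeSlope ℓ A x e⌋ + 1 / 2)
  else (if G.t e ∈ S then 1 / 2 - ⌈G.edgeSlope ℓ A x e⌉ else 0)

variable {ℓ}

lemma mem_crossEdges_compl (S : Finset G.V) (e : G.E) :
    e ∈ G.crossEdges S Sᶜ ↔ ¬ (G.s e ∈ S ↔ G.t e ∈ S) := by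
  simp only [crossEdges, Finset.mem_filter, Finset.mem_univ, true_and, Finset.mem_sdiff,
    Finset.mem_compl]
  tauto

open Filter Topology in
lemma eventually_edge_lower (hℓ : ∀ e, 0 < ℓ e) (x : G.V → ℝ) (S : Finset G.V) (e : G.E) :
    ∀ᶠ ε in 𝓝[>] (0 : ℝ),
      ℓ e * interpSq (G.edgeSlope ℓ A (G.lower x S ε) e) =
        ℓ e * interpSq (G.edgeSlope ℓ A x e) + ε * G.edgeDeriv ℓ A x S e ∧
      (e ∈ G.brokenEdges ℓ A x ∪ G.crossEdges S Sᶜ → e ∈ G.brokenEdges ℓ A (G.lower x S ε)) := by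
  have hs : ∀ ε, G.edgeSlope ℓ A (G.lower x S ε) e = G.edgeSlope ℓ A x e +
      ((if G.s e ∈ S then ε else 0) - if G.t e ∈ S then ε else 0) / ℓ e := by
    intro ε
    simp only [edgeSlope, lower]
    ring
  simp only [hs, edgeDeriv, Finset.mem_union, mem_crossEdges_compl, brokenEdges,
    Finset.mem_filter, Finset.mem_univ, true_and]
  by_cases h1 : G.s e ∈ S <;> by_cases h2 : G.t e ∈ S
  · simp [h1, h2]
  · filter_upwards [eventually_interpSq_add_div (G.edgeSlope ℓ A x e) (hℓ e)] with ε hε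
    simpa [h1, h2] using hε
  · filter_upwards [eventually_interpSq_sub_div (G.edgeSlope ℓ A x e) (hℓ e)] with ε hε
    simpa [h1, h2, neg_div, ← sub_eq_add_neg] using hε
  · simp [h1, h2]

open Filter Topology in
lemma eventually_energy_lower (hℓ : ∀ e, 0 < ℓ e) (x : G.V → ℝ) (S : Finset G.V) :
    ∀ᶠ ε in 𝓝[>] (0 : ℝ),
      G.energy ℓ A b (G.lower x S ε) =
        G.energy ℓ A b x + ε * (∑ v ∈ S, b v + ∑ e, G.edgeDeriv ℓ A x S e) ∧
      G.brokenEdges ℓ A x ∪ G.crossEdges S Sᶜ ⊆ G.brokenEdges ℓ A (G.lower x S ε) := by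
  filter_upwards [eventually_all.2 fun e => G.eventually_edge_lower A hℓ x S e] with ε hε
  refine ⟨?_, fun e he => (hε e).2 he⟩
  have hb : ∑ v, b v * G.lower x S ε v = ∑ v, b v * x v - ε * ∑ v ∈ S, b v := by
    simp only [lower, mul_sub, Finset.sum_sub_distrib, mul_ite, mul_zero, Finset.mul_sum]
    rw [Finset.sum_ite_mem, Finset.univ_inter]
    simp only [mul_comm]
  rw [energy, hb, Finset.sum_congr rfl fun e _ => (hε e).1, Finset.sum_add_distrib,
    ← Finset.mul_sum, energy]
  ring

lemma exists_abs_sub_le {u v : G.V} (h : Relation.EqvGen G.adj u v) :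
    ∃ K : ℝ, 0 ≤ K ∧ ∀ x : G.V → ℝ, |x u - x v| ≤ K * ∑ e, |x (G.t e) - x (G.s e)| := by
  induction h with
  | rel u v h =>
    obtain ⟨e, -, h⟩ := h
    refine ⟨1, zero_le_one, fun x => ?_⟩
    rw [one_mul]
    refine le_trans (le_of_eq ?_)
      (Finset.single_le_sum (fun e _ => abs_nonneg (x (G.t e) - x (G.s e))) (Finset.mem_univ e))
    rcases h with ⟨rfl, rfl⟩ | ⟨rfl, rfl⟩
    · exact abs_sub_comm _ _
    · rfl
  | refl u => exact ⟨0, le_rfl, fun x => by simp⟩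
  | symm u v _ ih =>
    obtain ⟨K, hK, h⟩ := ih
    exact ⟨K, hK, fun x => by rw [abs_sub_comm]; exact h x⟩
  | trans u v w _ _ ih₁ ih₂ =>
    obtain ⟨K₁, hK₁, h₁⟩ := ih₁
    obtain ⟨K₂, hK₂, h₂⟩ := ih₂
    refine ⟨K₁ + K₂, add_nonneg hK₁ hK₂, fun x => ?_⟩
    rw [add_mul]
    exact (abs_sub_le _ (x v) _).trans (add_le_add (h₁ x) (h₂ x))

lemma exists_abs_le (hconn : G.Connected) (v₀ : G.V) :
    ∃ K : ℝ, 0 ≤ K ∧ ∀ x : G.V → ℝ, x v₀ = 0 →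
      ∀ v, |x v| ≤ K * ∑ e, |x (G.t e) - x (G.s e)| := by
  choose K hK h using fun v => G.exists_abs_sub_le (hconn v v₀)
  refine ⟨∑ v, K v, Finset.sum_nonneg fun v _ => hK v, fun x hx v => ?_⟩
  have h1 := h v x
  rw [hx, sub_zero] at h1
  refine h1.trans (mul_le_mul_of_nonneg_right ?_ (Finset.sum_nonneg fun e _ => abs_nonneg _))
  exact Finset.single_le_sum (fun v _ => hK v) (Finset.mem_univ v)

lemma exists_sum_abs_le_energy (hconn : G.Connected) (hℓ : ∀ e, 0 < ℓ e) (v₀ : G.V) :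
    ∃ C : ℝ, ∀ x : G.V → ℝ, x v₀ = 0 →
      ∑ e, |x (G.t e) - x (G.s e)| ≤ G.energy ℓ A b x + C := by
  obtain ⟨K, hK, h⟩ := G.exists_abs_le hconn v₀
  set Λ : ℝ := (∑ v, |b v|) * K + 1 with hΛ
  have hΛ0 : 0 ≤ Λ := by positivity
  refine ⟨∑ e, (Λ * |A e| + Λ ^ 2 * ℓ e / 2), fun x hx => ?_⟩
  set T := ∑ e, |x (G.t e) - x (G.s e)| with hT
  have h1 : ∑ v, b v * x v ≤ (∑ v, |b v|) * K * T := by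
    rw [mul_assoc, Finset.sum_mul]
    refine Finset.sum_le_sum fun v _ => ?_
    calc b v * x v ≤ |b v * x v| := le_abs_self _
      _ = |b v| * |x v| := abs_mul _ _
      _ ≤ |b v| * (K * T) := mul_le_mul_of_nonneg_left (h x hx v) (abs_nonneg _)
  have h2 : Λ * T ≤ ∑ e, ℓ e * interpSq (G.edgeSlope ℓ A x e) +
      ∑ e, (Λ * |A e| + Λ ^ 2 * ℓ e / 2) := by
    rw [hT, Finset.mul_sum, ← Finset.sum_add_distrib]
    refine Finset.sum_le_sum fun e _ => ?_
    set u := G.edgeSlope ℓ A x e with hu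
    have hue : ℓ e * u = x (G.t e) - x (G.s e) - A e := by
      rw [hu, edgeSlope, mul_div_cancel₀ _ (hℓ e).ne']
    have h3 : |x (G.t e) - x (G.s e)| ≤ ℓ e * |u| + |A e| := by
      have h8 : ℓ e * |u| = |ℓ e * u| := by rw [abs_mul, abs_of_pos (hℓ e)]
      rw [h8, hue]
      simpa using abs_add_le (x (G.t e) - x (G.s e) - A e) (A e)
    have h4 : Λ * |u| - Λ ^ 2 / 2 ≤ interpSq u := by
      have := sq_div_two_le_interpSq u
      nlinarith [sq_nonneg (|u| - Λ), sq_abs u]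
    have h5 := mul_le_mul_of_nonneg_left h4 (hℓ e).le
    have h6 := mul_le_mul_of_nonneg_left h3 hΛ0
    linarith
  rw [energy]
  have h7 : Λ * T = (∑ v, |b v|) * K * T + T := by rw [hΛ]; ring
  linarith

lemma energy_sub_const (hb : ∑ v, b v = 0) (x : G.V → ℝ) (c : ℝ) :
    G.energy ℓ A b (fun v => x v - c) = G.energy ℓ A b x := by
  have h : ∀ e, G.edgeSlope ℓ A (fun v => x v - c) e = G.edgeSlope ℓ A x e := by
    intro e
    simp only [edgeSlope]
    ring
  simp only [energy, h, mul_sub, Finset.sum_sub_distrib, ← Finset.sum_mul, hb, zero_mul, sub_zero]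

lemma continuous_energy : Continuous (G.energy ℓ A b) := by
  have := continuous_interpSq
  unfold energy edgeSlope
  fun_prop

lemma exists_energy_minimizer (hconn : G.Connected) (hℓ : ∀ e, 0 < ℓ e) (hb : ∑ v, b v = 0) :
    ∃ x, ∀ y, G.energy ℓ A b x ≤ G.energy ℓ A b y := by
  rcases isEmpty_or_nonempty G.V with hV | ⟨⟨v₀⟩⟩
  · exact ⟨0, fun y => by rw [Subsingleton.elim y 0]⟩
  obtain ⟨K, hK, h⟩ := G.exists_abs_le hconn v₀
  obtain ⟨C, hC⟩ := G.exists_sum_abs_le_energy A b hconn hℓ v₀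
  set R := K * (G.energy ℓ A b 0 + C) with hR
  have hT0 : 0 ≤ G.energy ℓ A b 0 + C := by simpa using hC 0 rfl
  have hR0 : 0 ≤ R := mul_nonneg hK hT0
  obtain ⟨x, -, hx⟩ := (isCompact_closedBall (0 : G.V → ℝ) R).exists_isMinOn
    (Metric.nonempty_closedBall.2 hR0) (G.continuous_energy A b).continuousOn
  have hx0 : G.energy ℓ A b x ≤ G.energy ℓ A b 0 := hx (Metric.mem_closedBall_self hR0)
  refine ⟨x, fun y => ?_⟩
  rw [← G.energy_sub_const A b hb y (y v₀)]
  set z := fun v => y v - y v₀ with hz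
  have hz0 : z v₀ = 0 := sub_self _
  rcases le_total (G.energy ℓ A b 0) (G.energy ℓ A b z) with h1 | h1
  · exact hx0.trans h1
  · refine hx ?_
    rw [mem_closedBall_zero_iff, pi_norm_le_iff_of_nonneg hR0]
    intro v
    refine (h z hz0 v).trans (mul_le_mul_of_nonneg_left ?_ hK)
    linarith [hC z hz0]

/-- There is a potential for which all one-sided derivatives of the energy are nonnegative, and
those in the direction of a set whose cut contains an unbroken edge are positive. -/
lemma exists_stable_potential (hconn : G.Connected) (hℓ : ∀ e, 0 < ℓ e) (hb : ∑ v, b v = 0) :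
    ∃ x, ∀ S : Finset G.V, 0 ≤ ∑ v ∈ S, b v + ∑ e, G.edgeDeriv ℓ A x S e ∧
      (¬ G.crossEdges S Sᶜ ⊆ G.brokenEdges ℓ A x →
        0 < ∑ v ∈ S, b v + ∑ e, G.edgeDeriv ℓ A x S e) := by
  obtain ⟨x₀, hx₀⟩ := G.exists_energy_minimizer A b hconn hℓ hb
  obtain ⟨n, ⟨x, hx, rfl⟩, hmax⟩ : ∃ n, Maximal (fun n => ∃ x,
      (∀ y, G.energy ℓ A b x ≤ G.energy ℓ A b y) ∧ (G.brokenEdges ℓ A x).card = n) n := by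
    refine Set.Finite.exists_maximal (s := {n | ∃ x,
      (∀ y, G.energy ℓ A b x ≤ G.energy ℓ A b y) ∧ (G.brokenEdges ℓ A x).card = n}) ?_
      ⟨_, x₀, hx₀, rfl⟩
    refine (Set.finite_Iic (Fintype.card G.E)).subset ?_
    rintro _ ⟨x, -, rfl⟩
    exact Finset.card_le_univ _
  refine ⟨x, fun S => ?_⟩
  obtain ⟨ε, ⟨hE, hsub⟩, hε⟩ :=
    ((G.eventually_energy_lower A b hℓ x S).and self_mem_nhdsWithin).exists
  have hε : 0 < ε := hε
  have hnonneg : 0 ≤ ∑ v ∈ S, b v + ∑ e, G.edgeDeriv ℓ A x S e := by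
    have := hx (G.lower x S ε)
    rw [hE] at this
    exact nonneg_of_mul_nonneg_right (by linarith) hε
  refine ⟨hnonneg, fun hcross => hnonneg.lt_of_ne fun h0 => hcross ?_⟩
  rw [← h0, mul_zero, add_zero] at hE
  have hle := hmax ⟨G.lower x S ε, fun y => hE ▸ hx y, rfl⟩
    (Finset.card_le_card (Finset.subset_union_left.trans hsub))
  have heq := Finset.eq_of_subset_of_card_le (Finset.subset_union_left.trans hsub) hle
  rw [heq]
  exact Finset.subset_union_right.trans hsub

lemma sum_sum_ite_eq_mem {R : Type*} [AddCommMonoid R] (S : Finset G.V) (r : G.E → G.V)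
    (c : G.E → R) :
    ∑ v ∈ S, ∑ e, (if r e = v then c e else 0) = ∑ e, if r e ∈ S then c e else 0 := by
  rw [Finset.sum_comm]
  simp

lemma betaP_eq (μ : G.V → ℝ) (D₀ : G.V → ℤ) (M : G.E → ℤ) (x : G.V → ℝ) (P : PseudoDiv G)
    (hE : P.E = G.brokenEdges ℓ A x)
    (hD : ∀ v, P.D v = D₀ v + ∑ e, ((if G.s e = v then ⌈G.edgeSlope ℓ A x e⌉ else 0) +
      if G.t e = v then M e - ⌊G.edgeSlope ℓ A x e⌋ else 0)) (S : Finset G.V) :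
    G.betaP μ P S = ∑ v ∈ S, ((D₀ v : ℝ) - μ v + ∑ e, if G.t e = v then (M e : ℝ) else 0) +
      ∑ e, G.edgeDeriv ℓ A x S e := by
  have hval : ∀ v, (G.valE P.E v : ℝ) =
      ∑ e, (if G.s e = v then (if e ∈ P.E then (1 : ℝ) else 0) else 0) +
      ∑ e, (if G.t e = v then (if e ∈ P.E then (1 : ℝ) else 0) else 0) := by
    intro v
    rw [valE, Nat.cast_add, Finset.natCast_card_filter, Finset.natCast_card_filter]
    congr 1 <;>
    · rw [← Finset.sum_subset (Finset.subset_univ P.E) fun e _ he => by simp [he]]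
      exact Finset.sum_congr rfl fun e he => by simp [he]
  have hcross : (((G.crossEdges S Sᶜ).filter fun e => e ∉ P.E).card : ℝ) =
      ∑ e, if e ∈ G.crossEdges S Sᶜ ∧ e ∉ P.E then (1 : ℝ) else 0 := by
    rw [← Finset.natCast_card_filter, ← Finset.filter_filter]
    simp
  simp only [betaP, hcross, hval, hD, Int.cast_add, Int.cast_sum, Finset.sum_add_distrib,
    Finset.sum_sub_distrib, add_div, ← Finset.sum_div, apply_ite (Int.cast (R := ℝ)),
    Int.cast_zero, sum_sum_ite_eq_mem]
  have key : ∀ e, (if G.s e ∈ S then ((⌈G.edgeSlope ℓ A x e⌉ : ℤ) : ℝ) else 0) +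
      (if G.t e ∈ S then ((M e - ⌊G.edgeSlope ℓ A x e⌋ : ℤ) : ℝ) else 0) -
      ((if G.s e ∈ S then (if e ∈ P.E then (1 : ℝ) else 0) else 0) / 2 +
        (if G.t e ∈ S then (if e ∈ P.E then (1 : ℝ) else 0) else 0) / 2) +
      (if e ∈ G.crossEdges S Sᶜ ∧ e ∉ P.E then (1 : ℝ) else 0) / 2 =
      (if G.t e ∈ S then (M e : ℝ) else 0) + G.edgeDeriv ℓ A x S e := by
    intro e
    have hceil : ((⌈G.edgeSlope ℓ A x e⌉ : ℤ) : ℝ) =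
        ⌊G.edgeSlope ℓ A x e⌋ + if e ∈ P.E then (1 : ℝ) else 0 := by
      rw [hE]
      simp only [brokenEdges, Finset.mem_filter, Finset.mem_univ, true_and]
      split_ifs with h
      · rw [Int.ceil_eq_floor_add_one_iff_notMem _ |>.2]
        · push_cast; ring
        · rintro ⟨k, hk⟩
          exact h (by rw [← hk, Int.fract_intCast])
      · push Not at h
        obtain ⟨k, hk⟩ := Int.fract_eq_zero_iff.1 h
        rw [← hk]
        simp
    simp only [edgeDeriv, mem_crossEdges_compl]
    by_cases h1 : G.s e ∈ S <;> by_cases h2 : G.t e ∈ S <;> by_cases h3 : e ∈ P.E <;>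
      simp [h1, h2, h3, hceil] <;> ring
  have hsum := Finset.sum_congr (rfl : (Finset.univ : Finset G.E) = _) fun e _ => key e
  simp only [Finset.sum_add_distrib, Finset.sum_sub_distrib, ← Finset.sum_div] at hsum
  linarith

end Energy

end Multigraph

/-! ### Piecewise linear functions with prescribed kinks -/

/-- The piecewise linear function which is `c + N * t` to the left of all points of `B` and whose
slope increases by `m a` at each `a ∈ B`. -/
noncomputable def kinkFn (c : ℝ) (N : ℤ) (B : Finset ℝ) (m : ℝ → ℤ) (t : ℝ) : ℝ :=
  c + N * t + ∑ a ∈ B, (m a : ℝ) * max (t - a) 0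

lemma kinkFn_eq_on (c : ℝ) (N : ℤ) (B : Finset ℝ) (m : ℝ → ℤ) (B' : Finset ℝ) (hB : B' ⊆ B)
    {r t : ℝ} (h1 : ∀ a ∈ B', a ≤ r ∧ a ≤ t) (h2 : ∀ a ∈ B, a ∉ B' → r ≤ a ∧ t ≤ a) :
    kinkFn c N B m t = kinkFn c N B m r + ((N + ∑ a ∈ B', m a : ℤ) : ℝ) * (t - r) := by
  have h : ∀ y, (y = r ∨ y = t) →
      ∑ a ∈ B, (m a : ℝ) * max (y - a) 0 = ∑ a ∈ B', (m a : ℝ) * (y - a) := by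
    intro y hy
    rw [← Finset.sum_subset hB]
    · refine Finset.sum_congr rfl fun a ha => ?_
      rw [max_eq_left]
      rcases hy with rfl | rfl
      · linarith [(h1 a ha).1]
      · linarith [(h1 a ha).2]
    · intro a ha ha'
      rw [max_eq_right, mul_zero]
      rcases hy with rfl | rfl
      · linarith [(h2 a ha ha').1]
      · linarith [(h2 a ha ha').2]
  rw [kinkFn, kinkFn, h t (Or.inr rfl), h r (Or.inl rfl)]
  push_cast
  simp only [mul_sub, Finset.sum_sub_distrib, ← Finset.sum_mul]
  ring

lemma piecewiseLinear_kinkFn (c : ℝ) (N : ℤ) (B : Finset ℝ) (m : ℝ → ℤ) {L : ℝ} (hL : 0 ≤ L) :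
    PiecewiseLinear L (kinkFn c N B m) := by
  set C : Finset ℝ := insert 0 (insert L (B.filter fun a => 0 ≤ a ∧ a ≤ L)) with hC
  have h0 : (0 : ℝ) ∈ C := Finset.mem_insert_self _ _
  have hLC : L ∈ C := Finset.mem_insert_of_mem (Finset.mem_insert_self _ _)
  have hbd : ∀ a ∈ C, 0 ≤ a ∧ a ≤ L := by
    intro a ha
    simp only [hC, Finset.mem_insert, Finset.mem_filter] at ha
    rcases ha with rfl | rfl | ha
    · exact ⟨le_rfl, hL⟩
    · exact ⟨hL, le_rfl⟩
    · exact ha.2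
  obtain ⟨n, hn⟩ : ∃ n, C.card = n + 1 :=
    Nat.exists_eq_succ_of_ne_zero (Finset.card_ne_zero_of_mem h0)
  set x := C.orderEmbOfFin hn with hx
  have hmem : ∀ i, x i ∈ C := fun i => Finset.orderEmbOfFin_mem _ _ _
  have hsurj : ∀ a ∈ C, ∃ i, x i = a := by
    intro a ha
    have := Finset.range_orderEmbOfFin C hn
    exact Set.mem_range.1 (this ▸ ha)
  refine ⟨n, x, fun i => N + ∑ a ∈ B.filter fun a => a ≤ x i.castSucc, m a, ?_, ?_, x.monotone, ?_⟩
  · obtain ⟨i, hi⟩ := hsurj 0 h0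
    exact le_antisymm (hi ▸ x.monotone (Fin.zero_le i)) (hbd _ (hmem 0)).1
  · obtain ⟨i, hi⟩ := hsurj L hLC
    exact le_antisymm (hbd _ (hmem _)).2 (hi ▸ x.monotone (Fin.le_last i))
  · intro i t ht
    refine kinkFn_eq_on c N B m _ (Finset.filter_subset _ _) (fun a ha => ?_) fun a ha ha' => ?_
    · have := (Finset.mem_filter.1 ha).2
      exact ⟨this, this.trans ht.1⟩
    · have hlt : x i.castSucc < a := by
        by_contra h
        exact ha' (Finset.mem_filter.2 ⟨ha, not_lt.1 h⟩)
      refine ⟨hlt.le, ht.2.trans ?_⟩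
      by_cases haL : a ≤ L
      · have haC : a ∈ C := by
          simp only [hC, Finset.mem_insert, Finset.mem_filter]
          exact Or.inr (Or.inr ⟨ha, (hbd _ (hmem _)).1.trans hlt.le, haL⟩)
        obtain ⟨j, rfl⟩ := hsurj a haC
        exact x.monotone (Fin.castSucc_lt_iff_succ_le.1 (x.lt_iff_lt.1 hlt))
      · exact (hbd _ (hmem _)).2.trans (not_le.1 haL).le

open Filter Topology in
lemma rightSlope_kinkFn (c : ℝ) (N : ℤ) (B : Finset ℝ) (m : ℝ → ℤ) (r : ℝ) :
    rightSlope (kinkFn c N B m) r = N + ∑ a ∈ B.filter fun a => a ≤ r, (m a : ℝ) := by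
  set k : ℤ := N + ∑ a ∈ B.filter fun a => a ≤ r, m a with hk
  have hev : ∀ᶠ t in 𝓝[≥] r, kinkFn c N B m t = kinkFn c N B m r + (k : ℝ) * (t - r) := by
    have h1 : ∀ᶠ t in 𝓝[≥] r, ∀ a ∈ B, r < a → t ≤ a := by
      rw [Finset.eventually_all]
      intro a _
      by_cases h : r < a
      · exact (eventually_nhdsWithin_of_eventually_nhds (eventually_le_nhds h)).mono fun _ h _ => h
      · exact Eventually.of_forall fun _ h' => absurd h' h
    filter_upwards [h1, self_mem_nhdsWithin] with t ht htr
    refine kinkFn_eq_on c N B m _ (Finset.filter_subset _ _) (fun a ha => ?_) fun a ha ha' => ?_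
    · have := (Finset.mem_filter.1 ha).2
      exact ⟨this, this.trans htr⟩
    · have hlt : r < a := not_le.1 fun h => ha' (Finset.mem_filter.2 ⟨ha, h⟩)
      exact ⟨hlt.le, ht a ha hlt⟩
  have hd : HasDerivWithinAt (kinkFn c N B m) (k : ℝ) (Set.Ici r) r := by
    have h : HasDerivAt (fun t => kinkFn c N B m r + (k : ℝ) * (t - r)) (k : ℝ) r := by
      simpa using (((hasDerivAt_id r).sub_const r).const_mul (k : ℝ)).const_add (kinkFn c N B m r)
    exact h.hasDerivWithinAt.congr_of_eventuallyEq hev (by simp)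
  rw [rightSlope, hd.derivWithin (uniqueDiffWithinAt_Ici r), hk]
  push_cast
  rfl

open Filter Topology in
lemma leftSlope_kinkFn (c : ℝ) (N : ℤ) (B : Finset ℝ) (m : ℝ → ℤ) (r : ℝ) :
    leftSlope (kinkFn c N B m) r = N + ∑ a ∈ B.filter fun a => a < r, (m a : ℝ) := by
  set k : ℤ := N + ∑ a ∈ B.filter fun a => a < r, m a with hk
  have hev : ∀ᶠ t in 𝓝[≤] r, kinkFn c N B m t = kinkFn c N B m r + (k : ℝ) * (t - r) := by
    have h1 : ∀ᶠ t in 𝓝[≤] r, ∀ a ∈ B, a < r → a ≤ t := by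
      rw [Finset.eventually_all]
      intro a _
      by_cases h : a < r
      · exact (eventually_nhdsWithin_of_eventually_nhds (eventually_ge_nhds h)).mono fun _ h _ => h
      · exact Eventually.of_forall fun _ h' => absurd h' h
    filter_upwards [h1, self_mem_nhdsWithin] with t ht htr
    refine kinkFn_eq_on c N B m _ (Finset.filter_subset _ _) (fun a ha => ?_) fun a ha ha' => ?_
    · have := Finset.mem_filter.1 ha
      exact ⟨this.2.le, ht a this.1 this.2⟩
    · have hle : r ≤ a := not_lt.1 fun h => ha' (Finset.mem_filter.2 ⟨ha, h⟩)
      exact ⟨hle, le_trans htr hle⟩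
  have hd : HasDerivWithinAt (kinkFn c N B m) (k : ℝ) (Set.Iic r) r := by
    have h : HasDerivAt (fun t => kinkFn c N B m r + (k : ℝ) * (t - r)) (k : ℝ) r := by
      simpa using (((hasDerivAt_id r).sub_const r).const_mul (k : ℝ)).const_add (kinkFn c N B m r)
    exact h.hasDerivWithinAt.congr_of_eventuallyEq hev (by simp)
  rw [leftSlope, hd.derivWithin (uniqueDiffWithinAt_Iic r), hk]
  push_cast
  rfl

lemma leftSlope_sub_rightSlope_kinkFn (c : ℝ) (N : ℤ) (B : Finset ℝ) (m : ℝ → ℤ) (r : ℝ) :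
    leftSlope (kinkFn c N B m) r - rightSlope (kinkFn c N B m) r =
      if r ∈ B then -(m r : ℝ) else 0 := by
  rw [leftSlope_kinkFn, rightSlope_kinkFn, Finset.sum_filter, Finset.sum_filter,
    add_sub_add_left_eq_sub, ← Finset.sum_sub_distrib, ← Finset.sum_ite_eq B r fun a => -(m a : ℝ)]
  refine Finset.sum_congr rfl fun a _ => ?_
  rcases lt_trichotomy a r with h | rfl | h
  · simp [h, h.le, h.ne']
  · simp
  · simp [h.not_gt, h.not_ge, h.ne]

lemma sum_insert_mul (B : Finset ℝ) (δ m : ℝ → ℤ) (p : ℝ)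
    (hm : ∀ a, m a = -(if a ∈ B then δ a else 0) - if a = p then 1 else 0) (φ : ℝ → ℝ) :
    ∑ a ∈ insert p B, (m a : ℝ) * φ a = -∑ a ∈ B, (δ a : ℝ) * φ a - φ p := by
  have h1 : ∑ a ∈ insert p B, (if a ∈ B then (δ a : ℝ) * φ a else 0) =
      ∑ a ∈ B, (δ a : ℝ) * φ a := by
    rw [Finset.sum_ite_mem, Finset.inter_eq_right.2 (Finset.subset_insert p B)]
  have h2 : ∑ a ∈ insert p B, (if a = p then φ a else 0) = φ p := by
    rw [Finset.sum_ite_eq' (insert p B) p φ, if_pos (Finset.mem_insert_self p B)]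
  rw [← h1, ← h2, ← Finset.sum_neg_distrib, ← Finset.sum_sub_distrib]
  refine Finset.sum_congr rfl fun a _ => ?_
  rw [hm]
  split_ifs <;> push_cast <;> ring

/-! ### Divisors along the edges -/

lemma exists_edge_data {G : Multigraph} {ℓ : G.E → ℝ} (𝓓 : TropPt G ℓ → ℤ)
    (hfin : {x | 𝓓 x ≠ 0}.Finite) :
    ∃ (B : G.E → Finset ℝ) (δ : G.E → ℝ → ℤ),
      (∀ e, ∀ a ∈ B e, 0 < a ∧ a < ℓ e) ∧
      (∀ y, 𝓓 (Sum.inr y) = if y.1.2 ∈ B y.1.1 then δ y.1.1 y.1.2 else 0) ∧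
      ∑ᶠ x, 𝓓 x = ∑ v, 𝓓 (Sum.inl v) + ∑ e, ∑ a ∈ B e, δ e a := by
  let I := {p : G.E × ℝ // 0 < p.2 ∧ p.2 < ℓ p.1}
  let 𝓓' : G.V ⊕ I → ℤ := 𝓓
  have hfin' : {x | 𝓓' x ≠ 0}.Finite := hfin
  let F : Finset I := hfin'.toFinset.toRight
  have hF : ∀ y, y ∈ F ↔ 𝓓' (Sum.inr y) ≠ 0 := fun y => by
    simp only [F, Finset.mem_toRight, Set.Finite.mem_toFinset, Set.mem_ofPred_eq]
  let B : G.E → Finset ℝ := fun e => (F.filter fun y => y.1.1 = e).image fun y => y.1.2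
  let δ : G.E → ℝ → ℤ := fun e a =>
    if h : 0 < a ∧ a < ℓ e then 𝓓' (Sum.inr ⟨(e, a), h⟩) else 0
  have hδ : ∀ y : I, δ y.1.1 y.1.2 = 𝓓' (Sum.inr y) := fun y => dif_pos y.2
  refine ⟨B, δ, fun e a ha => ?_, fun y => ?_, ?_⟩
  · obtain ⟨y, hy, rfl⟩ := Finset.mem_image.1 ha
    rw [← (Finset.mem_filter.1 hy).2]
    exact y.2
  · split_ifs with h
    · exact (hδ y).symm
    · by_contra h0
      exact h (Finset.mem_image.2 ⟨y, Finset.mem_filter.2 ⟨(hF y).2 h0, rfl⟩, rfl⟩)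
  · have hsum : ∑ᶠ x, 𝓓' x = ∑ x ∈ Finset.univ.disjSum F, 𝓓' x := by
      refine finsum_eq_finsetSum_of_support_subset _ fun x hx => ?_
      rcases x with v | y
      · simp
      · simpa [hF] using hx
    have hedge : ∑ y ∈ F, 𝓓' (Sum.inr y) = ∑ e, ∑ a ∈ B e, δ e a := by
      rw [← Finset.sum_fiberwise F (fun y => y.1.1)]
      refine Finset.sum_congr rfl fun e _ => ?_
      rw [Finset.sum_image]
      · refine Finset.sum_congr rfl fun y hy => ?_
        rw [← (Finset.mem_filter.1 hy).2, hδ]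
      · intro y hy z hz hyz
        have h1 := (Finset.mem_filter.1 hy).2
        have h2 := (Finset.mem_filter.1 hz).2
        exact Subtype.ext (Prod.ext (h1.trans h2.symm) hyz)
    exact hsum.trans (by rw [Finset.sum_disjSum, hedge])

/-- on a tropical curve `X` with polarization `μ` of degree `d`
(supported on the vertices of its `μ`-model `Γ`), every degree-`d` divisor is linearly
equivalent to a `μ`-polystable divisor. -/
theorem exists_polystable_representative (G : Multigraph) (hconn : G.Connected)
    (ℓ : G.E → ℝ) (hℓ : ∀ e, 0 < ℓ e) (d : ℤ)
    (μ : G.V → ℝ) (hμ : ∑ v, μ v = (d : ℝ))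
    (𝓓 : TropPt G ℓ → ℤ) (hfin : {x | 𝓓 x ≠ 0}.Finite)
    (hdeg : ∑ᶠ x, 𝓓 x = d) :
    ∃ (P : PseudoDiv G) (p : G.E → ℝ),
      (∀ e ∈ P.E, 0 < p e ∧ p e < ℓ e) ∧ G.Polystable μ P ∧
      ∃ f : RatFn G ℓ,
        ∀ x : TropPt G ℓ, ((𝓓 x - unitaryDiv G ℓ P p x : ℤ) : ℝ) = f.div x := by
  obtain ⟨B, δ, hB, h𝓓, hsum⟩ := exists_edge_data 𝓓 hfin
  set M : G.E → ℤ := fun e => ∑ a ∈ B e, δ e a with hM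
  set A : G.E → ℝ := fun e => -∑ a ∈ B e, (δ e a : ℝ) * (ℓ e - a) with hA
  set b : G.V → ℝ := fun v => ((𝓓 (Sum.inl v) : ℤ) : ℝ) - μ v +
    ∑ e, if G.t e = v then (M e : ℝ) else 0 with hb
  have hb0 : ∑ v, b v = 0 := by
    have h := hsum.symm.trans hdeg
    have h' : (∑ v, ((𝓓 (Sum.inl v) : ℤ) : ℝ)) + ∑ e, (M e : ℝ) = d := by exact_mod_cast h
    simp only [hb, Finset.sum_add_distrib, Finset.sum_sub_distrib, G.sum_sum_ite_eq_mem, hμ,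
      Finset.mem_univ, if_true]
    linarith
  obtain ⟨x, hx⟩ := G.exists_stable_potential A b hconn hℓ hb0
  set u : G.E → ℝ := G.edgeSlope ℓ A x with hu
  set p : G.E → ℝ := fun e => Int.fract (u e) * ℓ e with hp
  set P : PseudoDiv G := ⟨G.brokenEdges ℓ A x, fun v => 𝓓 (Sum.inl v) +
    ∑ e, ((if G.s e = v then ⌈u e⌉ else 0) + if G.t e = v then M e - ⌊u e⌋ else 0)⟩ with hP
  have hPE : ∀ e, e ∈ P.E ↔ Int.fract (u e) ≠ 0 := fun e => by
    simp [hP, Multigraph.brokenEdges, hu]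
  have hp0 : ∀ e, 0 ≤ p e := fun e => mul_nonneg (Int.fract_nonneg _) (hℓ e).le
  have hpE : ∀ e, e ∈ P.E ↔ 0 < p e := fun e => by
    rw [hPE, (hp0 e).lt_iff_ne, ne_comm, hp, ne_comm]
    simp [(hℓ e).ne']
  have hpℓ : ∀ e, p e < ℓ e := fun e => by
    simpa [hp] using mul_lt_mul_of_pos_right (Int.fract_lt_one (u e)) (hℓ e)
  set m : G.E → ℝ → ℤ := fun e a => -(if a ∈ B e then δ e a else 0) - if a = p e then 1 else 0
    with hm
  have hmsum := fun e => sum_insert_mul (B e) (δ e) (m e) (p e) fun a => rfl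
  set g : G.E → ℝ → ℝ := fun e =>
    kinkFn (x (G.s e)) (⌊u e⌋ + 1) (insert (p e) (B e)) (m e) with hg
  have hright : ∀ e, rightSlope (g e) 0 = ⌈u e⌉ := fun e => by
    have h := hmsum e fun a => if a ≤ 0 then 1 else 0
    simp only [mul_ite, mul_one, mul_zero, ← Finset.sum_filter] at h
    rw [hg, rightSlope_kinkFn, h, Finset.filter_false_of_mem fun a ha => (hB e a ha).1.not_ge]
    by_cases he : Int.fract (u e) = 0
    · have hpe : p e = 0 := by simp [hp, he]
      obtain ⟨k, hk⟩ := Int.fract_eq_zero_iff.1 he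
      simp [hpe, ← hk]
    · have hpe : ¬ p e ≤ 0 := not_le.2 ((hpE e).1 ((hPE e).2 he))
      have hceil : ⌈u e⌉ = ⌊u e⌋ + 1 := by
        rw [Int.ceil_eq_floor_add_one_iff_notMem]
        rintro ⟨k, hk⟩
        exact he (by rw [← hk, Int.fract_intCast])
      simp [hpe, hceil]
  have hleft : ∀ e, leftSlope (g e) (ℓ e) = ⌊u e⌋ - M e := fun e => by
    have h := hmsum e fun a => if a < ℓ e then 1 else 0
    simp only [mul_ite, mul_one, mul_zero, ← Finset.sum_filter] at h
    rw [hg, leftSlope_kinkFn, h, Finset.filter_true_of_mem fun a ha => (hB e a ha).2,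
      if_pos (hpℓ e), hM]
    push_cast
    ring
  refine ⟨P, p, fun e he => ⟨(hpE e).1 he, hpℓ e⟩, fun S => ?_, ⟨x, g, fun e => ?_, fun e => ?_,
    fun e => piecewiseLinear_kinkFn _ _ _ _ (hℓ e).le⟩, ?_⟩
  · rw [G.betaP_eq A μ (fun v => 𝓓 (Sum.inl v)) M x P rfl (fun v => rfl) S]
    exact hx S
  · have h : ∑ a ∈ insert (p e) (B e), (m e a : ℝ) * max (0 - a) 0 = 0 := by
      refine Finset.sum_eq_zero fun a ha => ?_
      have ha0 : 0 ≤ a := by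
        rcases Finset.mem_insert.1 ha with rfl | ha
        · exact hp0 e
        · exact (hB e a ha).1.le
      rw [max_eq_right (by linarith), mul_zero]
    simp only [hg, kinkFn, h]
    ring
  · have h : ∑ a ∈ B e, (δ e a : ℝ) * max (ℓ e - a) 0 = -A e := by
      rw [hA, neg_neg]
      refine Finset.sum_congr rfl fun a ha => ?_
      rw [max_eq_left (by linarith [(hB e a ha).2])]
    have hue : ℓ e * u e = x (G.t e) - x (G.s e) - A e := by
      rw [hu, Multigraph.edgeSlope, mul_div_cancel₀ _ (hℓ e).ne']
    have hpe : p e = (u e - ⌊u e⌋) * ℓ e := rfl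
    simp only [hg, kinkFn, hmsum e fun a => max (ℓ e - a) 0]
    rw [h, max_eq_left (by linarith [hpℓ e]), hpe]
    push_cast
    linarith
  · rintro (v | y)
    · simp only [unitaryDiv, RatFn.div, hright, hleft, hP]
      rw [sub_add_cancel_left, ← Finset.sum_neg_distrib, Int.cast_sum]
      refine Finset.sum_congr rfl fun e _ => ?_
      split_ifs <;> push_cast <;> ring
    · simp only [unitaryDiv, RatFn.div, hg, leftSlope_sub_rightSlope_kinkFn]
      obtain ⟨⟨e, t⟩, ht⟩ := y
      have hiff : (e ∈ P.E ∧ p e = t) ↔ t = p e :=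
        ⟨fun h => h.2.symm, fun h => ⟨(hpE e).2 (h ▸ ht.1), h.symm⟩⟩
      rw [h𝓓]
      simp only [hiff, Finset.mem_insert, hm]
      by_cases h : t = p e
      · simp [h, add_comm]
      · by_cases h' : t ∈ B e <;> simp [h, h']
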